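/- arXiv:1412.8269 — 3 statements merged into one kernel-verified Lean document; each statement's English description precedes it below -/
import Mathlib

section
/- For any 0-dimensional finite simplicial complex L (a nonempty finite set of vertices), the reduced cohomeology groups satisfy 𝓗̃^{p,q}(L) = 0 unless (p,q) = (0,0), and 𝓗̃^{0,0}(L) ≅ ℤ. -/
open Finset

/-- A finite abstract simplicial complex with vertices in `ℕ`. -/
structure SC where
  faces : Finset (Finset ℕ)
  down_closed : ∀ ⦃s t : Finset ℕ⦄, s ∈ faces → t ⊆ s → t ∈ faces

namespace SC

/-- The vertex set of a simplicial complex. -/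
def verts (K : SC) : Finset ℕ := K.faces.sup id

/-- The dimension of a simplicial complex (dimension of `{∅}` is `-1`). -/
def dim (K : SC) : ℤ := ((K.faces.sup Finset.card : ℕ) : ℤ) - 1

/-- The link of a simplex. -/
def link (K : SC) (σ : Finset ℕ) : SC where
  faces := K.faces.filter fun t => σ ∪ t ∈ K.faces ∧ Disjoint σ t
  down_closed := by
    intro s t hs hts
    simp only [mem_filter] at hs ⊢
    refine ⟨K.down_closed hs.1 hts, K.down_closed hs.2.1 (union_subset_union_right hts),
      hs.2.2.mono_right ?_⟩
    exact_mod_cast hts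

/-- `K₁` is a subcomplex of `K`. -/
def IsSub (K₁ K : SC) : Prop := K₁.faces ⊆ K.faces

/-- Union of two simplicial complexes. -/
def union (K L : SC) : SC where
  faces := K.faces ∪ L.faces
  down_closed := by
    intro s t hs hts
    rcases mem_union.mp hs with h | h
    · exact mem_union_left _ (K.down_closed h hts)
    · exact mem_union_right _ (L.down_closed h hts)

/-- Intersection of two simplicial complexes. -/
def inter (K L : SC) : SC where
  faces := K.faces ∩ L.faces
  down_closed := by
    intro s t hs hts
    rw [mem_inter] at hs ⊢
    exact ⟨K.down_closed hs.1 hts, L.down_closed hs.2 hts⟩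

/-- The join of two simplicial complexes. -/
def join (K L : SC) : SC where
  faces := (K.faces ×ˢ L.faces).image fun x => x.1 ∪ x.2
  down_closed := by
    intro s t hs hts
    simp only [mem_image, mem_product] at hs ⊢
    obtain ⟨⟨a, b⟩, ⟨ha, hb⟩, rfl⟩ := hs
    refine ⟨⟨t ∩ a, t \ a⟩, ⟨K.down_closed ha inter_subset_right,
      L.down_closed hb fun x hx => ?_⟩, ?_⟩
    · rcases mem_union.mp (hts (mem_sdiff.mp hx).1) with h | h
      · exact absurd h (mem_sdiff.mp hx).2
      · exact h
    · ext x
      simp only [mem_union, mem_inter, mem_sdiff]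
      constructor
      · rintro (⟨h, _⟩ | ⟨h, _⟩) <;> exact h
      · intro hx
        by_cases hxa : x ∈ a
        · exact Or.inl ⟨hx, hxa⟩
        · exact Or.inr ⟨hx, hxa⟩

end SC
namespace SC
open Finset

/-- The sign of a vertex `v` in a simplex, given by its position in the canonical ordering. -/
def psgn (v : ℕ) (s : Finset ℕ) : ℤ := (-1) ^ (s.filter fun u => u < v).card

variable (G : Type) [AddCommGroup G]

/-- The submodule of functions supported on a given set of indices. -/
def suppM {α : Type} (P : α → Prop) : Submodule ℤ (α → G) where
  carrier := {c | ∀ x, c x ≠ 0 → P x}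
  add_mem' := by
    intro a b ha hb x hx
    by_cases h : a x = 0
    · exact hb x (by simpa [h] using hx)
    · exact ha x h
  zero_mem' := fun x hx => absurd rfl hx
  smul_mem' := by
    intro z a ha x hx
    exact ha x fun h => hx (by simp [h])

end SC
namespace SC
open Finset

/-- Pairs of simplices, indexing the double complex `N^{*,*}`. -/
abbrev Pr := Finset ℕ × Finset ℕ

variable (G : Type) [AddCommGroup G]

/-- The `(p,q)`-graded piece of the double complex `N^{*,*}(K)` spanned by `σ ⊗ τ`, `σ ⊆ τ`. -/
def Ngr (K : SC) (p q : ℤ) : Submodule ℤ (Pr → G) :=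
  suppM G fun x => x.1 ⊆ x.2 ∧ x.2 ∈ K.faces ∧ x.1 ≠ ∅ ∧
    (x.1.card : ℤ) = p + 1 ∧ (x.2.card : ℤ) = q + 1

/-- The `(p,q)`-graded piece of the reduced double complex `Ñ^{*,*}(K)`. -/
def NgrR (K : SC) (p q : ℤ) : Submodule ℤ (Pr → G) :=
  suppM G fun x => x.1 ⊆ x.2 ∧ x.2 ∈ K.faces ∧
    (x.1.card : ℤ) = p + 1 ∧ (x.2.card : ℤ) = q + 1

/-- The vertical differential `σ ⊗ τ ↦ (-1)^{|σ|} σ ⊗ δτ` (unreduced). -/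
def dvF (K : SC) (c : Pr → G) : Pr → G := fun x =>
  if x.2 ∈ K.faces ∧ x.1 ⊆ x.2 ∧ x.1 ≠ ∅ then
    ((-1 : ℤ) ^ x.1.card) •
      ∑ w ∈ x.2, if x.1 ⊆ x.2.erase w then psgn w x.2 • c (x.1, x.2.erase w) else 0
  else 0

/-- The horizontal differential `σ ⊗ τ ↦ dσ ⊗ τ` (unreduced). -/
def dhF (K : SC) (c : Pr → G) : Pr → G := fun x =>
  if x.2 ∈ K.faces ∧ x.1 ⊆ x.2 ∧ x.1 ≠ ∅ then
    ∑ v ∈ x.2 \ x.1, psgn v (insert v x.1) • c (insert v x.1, x.2)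
  else 0

/-- The vertical differential (reduced). -/
def dvRF (K : SC) (c : Pr → G) : Pr → G := fun x =>
  if x.2 ∈ K.faces ∧ x.1 ⊆ x.2 then
    ((-1 : ℤ) ^ x.1.card) •
      ∑ w ∈ x.2, if x.1 ⊆ x.2.erase w then psgn w x.2 • c (x.1, x.2.erase w) else 0
  else 0

/-- The horizontal differential (reduced). -/
def dhRF (K : SC) (c : Pr → G) : Pr → G := fun x =>
  if x.2 ∈ K.faces ∧ x.1 ⊆ x.2 then
    ∑ v ∈ x.2 \ x.1, psgn v (insert v x.1) • c (insert v x.1, x.2)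
  else 0

/-- The vertical differential as a linear map (unreduced). -/
def dvL (K : SC) : (Pr → G) →ₗ[ℤ] (Pr → G) where
  toFun := dvF G K
  map_add' := by
    intro a b
    funext x
    simp only [dvF, Pi.add_apply]
    split_ifs with h
    · rw [← smul_add, ← Finset.sum_add_distrib]
      congr 1
      refine Finset.sum_congr rfl fun w _ => ?_
      split_ifs with h2
      · simp [smul_add]
      · simp
    · simp
  map_smul' := by
    intro z a
    funext x
    simp only [dvF, Pi.smul_apply, RingHom.id_apply]
    split_ifs with h
    · rw [smul_comm z]
      congr 1
      rw [Finset.smul_sum]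
      refine Finset.sum_congr rfl fun w _ => ?_
      split_ifs with h2
      · rw [smul_smul, smul_smul, mul_comm]
      · simp
    · simp

/-- The horizontal differential as a linear map (unreduced). -/
def dhL (K : SC) : (Pr → G) →ₗ[ℤ] (Pr → G) where
  toFun := dhF G K
  map_add' := by
    intro a b
    funext x
    simp only [dhF, Pi.add_apply]
    split_ifs with h
    · rw [← Finset.sum_add_distrib]
      exact Finset.sum_congr rfl fun v _ => smul_add _ _ _
    · simp
  map_smul' := by
    intro z a
    funext x
    simp only [dhF, Pi.smul_apply, RingHom.id_apply]
    split_ifs with h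
    · rw [Finset.smul_sum]
      refine Finset.sum_congr rfl fun v _ => ?_
      rw [smul_smul, smul_smul, mul_comm]
    · simp

/-- The vertical differential as a linear map (reduced). -/
def dvRL (K : SC) : (Pr → G) →ₗ[ℤ] (Pr → G) where
  toFun := dvRF G K
  map_add' := by
    intro a b
    funext x
    simp only [dvRF, Pi.add_apply]
    split_ifs with h
    · rw [← smul_add, ← Finset.sum_add_distrib]
      congr 1
      refine Finset.sum_congr rfl fun w _ => ?_
      split_ifs with h2
      · simp [smul_add]
      · simp
    · simp
  map_smul' := by
    intro z a
    funext x
    simp only [dvRF, Pi.smul_apply, RingHom.id_apply]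
    split_ifs with h
    · rw [smul_comm z]
      congr 1
      rw [Finset.smul_sum]
      refine Finset.sum_congr rfl fun w _ => ?_
      split_ifs with h2
      · rw [smul_smul, smul_smul, mul_comm]
      · simp
    · simp

/-- The horizontal differential as a linear map (reduced). -/
def dhRL (K : SC) : (Pr → G) →ₗ[ℤ] (Pr → G) where
  toFun := dhRF G K
  map_add' := by
    intro a b
    funext x
    simp only [dhRF, Pi.add_apply]
    split_ifs with h
    · rw [← Finset.sum_add_distrib]
      exact Finset.sum_congr rfl fun v _ => smul_add _ _ _
    · simp
  map_smul' := by
    intro z a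
    funext x
    simp only [dhRF, Pi.smul_apply, RingHom.id_apply]
    split_ifs with h
    · rw [Finset.smul_sum]
      refine Finset.sum_congr rfl fun v _ => ?_
      rw [smul_smul, smul_smul, mul_comm]
    · simp

/-- The total differential `Δ(σ⊗τ) = dσ⊗τ + (-1)^{|σ|}σ⊗δτ` (unreduced). -/
def dL (K : SC) : (Pr → G) →ₗ[ℤ] (Pr → G) := dhL G K + dvL G K

/-- The total differential (reduced). -/
def dRL (K : SC) : (Pr → G) →ₗ[ℤ] (Pr → G) := dhRL G K + dvRL G K

/-- Cocycles for the `E₁`-page: `ker Δ_v` in bidegree `(p,q)`. -/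
def Z1 (K : SC) (p q : ℤ) : Submodule ℤ (Pr → G) :=
  Ngr G K p q ⊓ LinearMap.ker (dvL G K)

/-- Coboundaries for the `E₁`-page. -/
def B1 (K : SC) (p q : ℤ) : Submodule ℤ (Pr → G) :=
  Submodule.map (dvL G K) (Ngr G K p (q - 1)) ⊓ Ngr G K p q

/-- The `E₁`-page of the cohomeology spectral sequence in bidegree `(p,q)`. -/
abbrev E1 (K : SC) (p q : ℤ) :=
  ↥(Z1 G K p q) ⧸ Submodule.comap (Z1 G K p q).subtype (B1 G K p q)

/-- Reduced `E₁`-cocycles. -/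
def Z1R (K : SC) (p q : ℤ) : Submodule ℤ (Pr → G) :=
  NgrR G K p q ⊓ LinearMap.ker (dvRL G K)

/-- Reduced `E₁`-coboundaries. -/
def B1R (K : SC) (p q : ℤ) : Submodule ℤ (Pr → G) :=
  Submodule.map (dvRL G K) (NgrR G K p (q - 1)) ⊓ NgrR G K p q

/-- The `E₁`-page of the reduced cohomeology spectral sequence. -/
abbrev E1R (K : SC) (p q : ℤ) :=
  ↥(Z1R G K p q) ⧸ Submodule.comap (Z1R G K p q).subtype (B1R G K p q)

/-- `E₂`-cocycles: vertical cocycles whose horizontal differential is a vertical coboundary. -/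
def Z2 (K : SC) (p q : ℤ) : Submodule ℤ (Pr → G) :=
  Ngr G K p q ⊓ LinearMap.ker (dvL G K) ⊓
    Submodule.comap (dhL G K) (Submodule.map (dvL G K) (Ngr G K (p - 1) (q - 1)))

/-- `E₂`-coboundaries. -/
def B2 (K : SC) (p q : ℤ) : Submodule ℤ (Pr → G) :=
  (Submodule.map (dvL G K) (Ngr G K p (q - 1)) ⊔
    Submodule.map (dhL G K) (Ngr G K (p + 1) q ⊓ LinearMap.ker (dvL G K))) ⊓ Ngr G K p q

/-- The cohomeology group `𝓗^{p,q}(K; G)`: the `E₂`-page of the cohomeology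
spectral sequence in bidegree `(p,q)`. -/
abbrev HH (K : SC) (p q : ℤ) :=
  ↥(Z2 G K p q) ⧸ Submodule.comap (Z2 G K p q).subtype (B2 G K p q)

/-- Reduced `E₂`-cocycles. -/
def Z2R (K : SC) (p q : ℤ) : Submodule ℤ (Pr → G) :=
  NgrR G K p q ⊓ LinearMap.ker (dvRL G K) ⊓
    Submodule.comap (dhRL G K) (Submodule.map (dvRL G K) (NgrR G K (p - 1) (q - 1)))

/-- Reduced `E₂`-coboundaries. -/
def B2R (K : SC) (p q : ℤ) : Submodule ℤ (Pr → G) :=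
  (Submodule.map (dvRL G K) (NgrR G K p (q - 1)) ⊔
    Submodule.map (dhRL G K) (NgrR G K (p + 1) q ⊓ LinearMap.ker (dvRL G K))) ⊓ NgrR G K p q

/-- The reduced cohomeology group `𝓗̃^{p,q}(K; G)`. -/
abbrev HHR (K : SC) (p q : ℤ) :=
  ↥(Z2R G K p q) ⧸ Submodule.comap (Z2R G K p q).subtype (B2R G K p q)

/-- Total-degree-`n` part of the total complex of `N^{*,*}(K)`. -/
def Tgr (K : SC) (n : ℤ) : Submodule ℤ (Pr → G) :=
  suppM G fun x => x.1 ⊆ x.2 ∧ x.2 ∈ K.faces ∧ x.1 ≠ ∅ ∧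
    (x.2.card : ℤ) - (x.1.card : ℤ) = n

/-- Total-degree-`n` part of the total complex of `Ñ^{*,*}(K)`. -/
def TgrR (K : SC) (n : ℤ) : Submodule ℤ (Pr → G) :=
  suppM G fun x => x.1 ⊆ x.2 ∧ x.2 ∈ K.faces ∧
    (x.2.card : ℤ) - (x.1.card : ℤ) = n

/-- The degree-`n` cohomology of the total complex of `N^{*,*}(K)`. -/
abbrev TotH (K : SC) (n : ℤ) :=
  ↥(Tgr G K n ⊓ LinearMap.ker (dL G K)) ⧸
    Submodule.comap (Tgr G K n ⊓ LinearMap.ker (dL G K)).subtype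
      (Submodule.map (dL G K) (Tgr G K (n - 1)) ⊓ Tgr G K n)

/-- The degree-`n` cohomology of the total complex of `Ñ^{*,*}(K)`. -/
abbrev TotHR (K : SC) (n : ℤ) :=
  ↥(TgrR G K n ⊓ LinearMap.ker (dRL G K)) ⧸
    Submodule.comap (TgrR G K n ⊓ LinearMap.ker (dRL G K)).subtype
      (Submodule.map (dRL G K) (TgrR G K (n - 1)) ⊓ TgrR G K n)

/-- The filtration `F^p` of the total complex by first degree. -/
def Fil (p : ℤ) : Submodule ℤ (Pr → G) :=
  suppM G fun x => (x.1.card : ℤ) ≤ p + 1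

/-- The `E_∞`-term of the cohomeology spectral sequence in bidegree `(p,p)`:
the `p`-th graded piece of the filtration induced on `H^0` of the total complex. -/
abbrev Einf0 (K : SC) (p : ℤ) :=
  ↥(Tgr ℤ K 0 ⊓ LinearMap.ker (dL ℤ K) ⊓ Fil ℤ p) ⧸
    Submodule.comap (Tgr ℤ K 0 ⊓ LinearMap.ker (dL ℤ K) ⊓ Fil ℤ p).subtype
      ((Tgr ℤ K 0 ⊓ LinearMap.ker (dL ℤ K) ⊓ Fil ℤ (p - 1)) ⊔
        (Submodule.map (dL ℤ K) (Tgr ℤ K (-1)) ⊓ Tgr ℤ K 0 ⊓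
          LinearMap.ker (dL ℤ K) ⊓ Fil ℤ p))

end SC

namespace SC

lemma card_le_one_of_dim_eq_zero {L : SC} (hdim : L.dim = 0) {s : Finset ℕ}
    (hs : s ∈ L.faces) : s.card ≤ 1 := by
  have h : s.card ≤ L.faces.sup Finset.card := Finset.le_sup hs
  unfold dim at hdim
  omega

lemma exists_singleton_mem_of_dim_eq_zero {L : SC} (hdim : L.dim = 0) :
    ∃ v, {v} ∈ L.faces := by
  have hsup : L.faces.sup Finset.card = 1 := by
    unfold dim at hdim
    omega
  have hne : L.faces.Nonempty := by
    rw [Finset.nonempty_iff_ne_empty]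
    intro h
    simp [h] at hsup
  obtain ⟨s, hs, hcard⟩ := Finset.exists_mem_eq_sup L.faces hne Finset.card
  obtain ⟨v, rfl⟩ := Finset.card_eq_one.mp (hcard.symm.trans hsup)
  exact ⟨v, hs⟩

variable {G : Type} [AddCommGroup G]

lemma psgn_singleton (v : ℕ) : psgn v {v} = 1 := by
  simp [psgn, Finset.filter_singleton]

lemma mem_NgrR {K : SC} {p q : ℤ} {c : Pr → G} :
    c ∈ NgrR G K p q ↔ ∀ x, c x ≠ 0 → x.1 ⊆ x.2 ∧ x.2 ∈ K.faces ∧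
      (x.1.card : ℤ) = p + 1 ∧ (x.2.card : ℤ) = q + 1 :=
  Iff.rfl

/-- Vertices and the empty simplex are the only faces of a `0`-dimensional complex, so the vertical
differential is determined by the value at `∅ ⊗ ∅`. -/
lemma dvRL_apply_of_dim_eq_zero {L : SC} (hdim : L.dim = 0) (c : Pr → G) (x : Pr) :
    dvRL G L c x = if x.1 = ∅ ∧ x.2 ∈ L.faces ∧ x.2.card = 1 then c (∅, ∅) else 0 := by
  obtain ⟨s, t⟩ := x
  change dvRF G L c (s, t) = _
  unfold dvRF
  by_cases ht : t ∈ L.faces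
  swap
  · simp [ht]
  rcases Nat.le_one_iff_eq_zero_or_eq_one.mp (card_le_one_of_dim_eq_zero hdim ht) with h | h
  · obtain rfl := Finset.card_eq_zero.mp h
    simp
  · obtain ⟨v, rfl⟩ := Finset.card_eq_one.mp h
    by_cases hs : s = ∅
    · subst hs
      simp [ht, psgn_singleton]
    · simp [hs]

/-- In a `0`-dimensional complex, the horizontal differential sends `v ⊗ v` to `∅ ⊗ v`. -/
lemma dhRL_apply_of_dim_eq_zero {L : SC} (hdim : L.dim = 0) (c : Pr → G) (x : Pr) :
    dhRL G L c x = if x.1 = ∅ ∧ x.2 ∈ L.faces ∧ x.2.card = 1 then c (x.2, x.2) else 0 := by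
  obtain ⟨s, t⟩ := x
  change dhRF G L c (s, t) = _
  unfold dhRF
  by_cases ht : t ∈ L.faces
  swap
  · simp [ht]
  rcases Nat.le_one_iff_eq_zero_or_eq_one.mp (card_le_one_of_dim_eq_zero hdim ht) with h | h
  · obtain rfl := Finset.card_eq_zero.mp h
    simp
  · obtain ⟨v, rfl⟩ := Finset.card_eq_one.mp h
    by_cases hs : s = ∅
    · subst hs
      simp [ht, psgn_singleton]
    · simp only [hs, false_and, if_false]
      split_ifs with hsub
      · obtain rfl := (Finset.subset_singleton_iff.mp hsub.2).resolve_left hs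
        simp
      · rfl

lemma NgrR_eq_bot_of_dim_eq_zero {L : SC} (hdim : L.dim = 0) {p q : ℤ}
    (h : ¬(p = 0 ∧ q = 0) ∧ ¬(p = -1 ∧ q = 0) ∧ ¬(p = -1 ∧ q = -1)) : NgrR G L p q = ⊥ := by
  rw [eq_bot_iff]
  intro c hc
  rw [Submodule.mem_bot]
  funext x
  by_contra hx
  obtain ⟨hsub, hface, h1, h2⟩ := mem_NgrR.mp hc x hx
  have := Finset.card_le_card hsub
  have := card_le_one_of_dim_eq_zero hdim hface
  omega

lemma dvRL_eq_zero_of_mem_NgrR {L : SC} (hdim : L.dim = 0) {p q : ℤ} (hq : q ≠ -1) {c : Pr → G}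
    (hc : c ∈ NgrR G L p q) : dvRL G L c = 0 := by
  funext x
  rw [dvRL_apply_of_dim_eq_zero hdim]
  have h0 : c (∅, ∅) = 0 := by
    by_contra h
    have := (mem_NgrR.mp hc _ h).2.2.2
    simp at this
    omega
  simp [h0]

lemma subsingleton_HHR_of_le {L : SC} {p q : ℤ} (h : Z2R G L p q ≤ B2R G L p q) :
    Subsingleton (HHR G L p q) := by
  rw [Submodule.Quotient.subsingleton_iff, Submodule.comap_subtype_eq_top]
  exact h

lemma Z2R_neg_one_neg_one_of_dim_eq_zero {L : SC} (hdim : L.dim = 0) :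
    Z2R G L (-1) (-1) = ⊥ := by
  rw [eq_bot_iff]
  rintro c ⟨⟨hc, hker⟩, -⟩
  obtain ⟨v, hv⟩ := exists_singleton_mem_of_dim_eq_zero hdim
  have hdv : dvRL G L c (∅, {v}) = 0 := congrFun (LinearMap.mem_ker.mp hker) _
  rw [dvRL_apply_of_dim_eq_zero hdim] at hdv
  simp only [hv, Finset.card_singleton, and_self, if_true] at hdv
  rw [Submodule.mem_bot]
  funext ⟨s, t⟩
  by_contra hx
  obtain ⟨-, -, h1, h2⟩ := mem_NgrR.mp hc _ hx
  obtain rfl : s = ∅ := by simpa using h1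
  obtain rfl : t = ∅ := by simpa using h2
  exact hx hdv

lemma NgrR_neg_one_zero_le_B2R_of_dim_eq_zero {L : SC} (hdim : L.dim = 0) :
    NgrR G L (-1) 0 ≤ B2R G L (-1) 0 := by
  intro c hc
  refine ⟨Submodule.mem_sup_right ?_, hc⟩
  have hmem : (fun x : Pr => if x.1 = x.2 then c (∅, x.2) else 0) ∈ NgrR G L (-1 + 1) 0 := by
    rw [mem_NgrR]
    rintro ⟨s, t⟩ hx
    simp only [ne_eq, ite_eq_right_iff, Classical.not_imp] at hx
    obtain ⟨rfl, hx⟩ := hx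
    obtain ⟨-, hface, -, hcard⟩ := mem_NgrR.mp hc _ hx
    exact ⟨subset_rfl, hface, by simpa using hcard, hcard⟩
  refine ⟨_, ⟨hmem, LinearMap.mem_ker.mpr
    (dvRL_eq_zero_of_mem_NgrR hdim (by norm_num) hmem)⟩, ?_⟩
  funext ⟨s, t⟩
  rw [dhRL_apply_of_dim_eq_zero hdim]
  simp only [if_true]
  split_ifs with h
  · rw [h.1]
  · by_contra hx
    obtain ⟨-, hface, h1, h2⟩ := mem_NgrR.mp hc _ (Ne.symm hx)
    exact h ⟨by simpa using h1, hface, by simpa using h2⟩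

lemma B2R_zero_zero_of_dim_eq_zero {L : SC} (hdim : L.dim = 0) : B2R G L 0 0 = ⊥ := by
  have h1 : NgrR G L 0 (0 - 1) = ⊥ := NgrR_eq_bot_of_dim_eq_zero hdim (by norm_num)
  have h2 : NgrR G L (0 + 1) 0 = ⊥ := NgrR_eq_bot_of_dim_eq_zero hdim (by norm_num)
  rw [B2R, h1, h2]
  simp

/-- A cochain of bidegree `(0, 0)` in a `0`-dimensional complex is an `E₂`-cocycle exactly when it
takes the same value at every `v ⊗ v`. -/
lemma mem_Z2R_zero_zero_iff {L : SC} (hdim : L.dim = 0) {c : Pr → G} :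
    c ∈ Z2R G L 0 0 ↔
      c ∈ NgrR G L 0 0 ∧ ∃ g, ∀ v, {v} ∈ L.faces → c ({v}, {v}) = g := by
  constructor
  · rintro ⟨⟨hc, -⟩, b, -, hb⟩
    refine ⟨hc, b (∅, ∅), fun v hv => ?_⟩
    have h := congrFun hb (∅, {v})
    rw [dvRL_apply_of_dim_eq_zero hdim, dhRL_apply_of_dim_eq_zero hdim] at h
    simpa [hv] using h.symm
  · rintro ⟨hc, g, hg⟩
    refine ⟨⟨hc, LinearMap.mem_ker.mpr (dvRL_eq_zero_of_mem_NgrR hdim (by norm_num) hc)⟩,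
      fun x => if x = (∅, ∅) then g else 0, ?_, ?_⟩
    · refine mem_NgrR.mpr fun x hx => ?_
      obtain ⟨v, hv⟩ := exists_singleton_mem_of_dim_eq_zero hdim
      simp only [ne_eq, ite_eq_right_iff, Classical.not_imp] at hx
      obtain ⟨rfl, -⟩ := hx
      exact ⟨subset_rfl, L.down_closed hv (Finset.empty_subset _), by simp, by simp⟩
    · funext ⟨s, t⟩
      rw [dvRL_apply_of_dim_eq_zero hdim, dhRL_apply_of_dim_eq_zero hdim]
      simp only [if_true]
      split_ifs with h
      · obtain ⟨v, rfl⟩ := Finset.card_eq_one.mp h.2.2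
        exact (hg v h.2.1).symm
      · rfl

lemma bijective_eval_Z2R_zero_zero {L : SC} (hdim : L.dim = 0) {v : ℕ} (hv : {v} ∈ L.faces) :
    Function.Bijective
      ((LinearMap.proj (R := ℤ) (φ := fun _ : Pr => G) ({v}, {v})).comp
        (Z2R G L 0 0).subtype) := by
  constructor
  · rw [← LinearMap.ker_eq_bot, eq_bot_iff]
    rintro ⟨c, hmem⟩ hzero
    have hcv : c ({v}, {v}) = 0 := hzero
    obtain ⟨hc, g, hg⟩ := (mem_Z2R_zero_zero_iff hdim).mp hmem
    rw [Submodule.mem_bot, Submodule.mk_eq_zero]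
    funext ⟨s, t⟩
    by_contra hx
    obtain ⟨hsub, hface, h1, h2⟩ := mem_NgrR.mp hc _ hx
    obtain ⟨w, rfl⟩ := Finset.card_eq_one.mp (show t.card = 1 by simpa using h2)
    obtain rfl : s = {w} := Finset.eq_of_subset_of_card_le hsub (by simp_all)
    exact hx ((hg w hface).trans ((hg v hv).symm.trans hcv))
  · intro g
    refine ⟨⟨fun x => if x.1 = x.2 ∧ x.2 ∈ L.faces ∧ x.2.card = 1 then g else 0,
      (mem_Z2R_zero_zero_iff hdim).mpr ⟨mem_NgrR.mpr ?_, g, ?_⟩⟩, ?_⟩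
    · rintro ⟨s, t⟩ hx
      simp only [ne_eq, ite_eq_right_iff, Classical.not_imp] at hx
      obtain ⟨⟨rfl, hface, hcard⟩, -⟩ := hx
      exact ⟨subset_rfl, hface, by simp [hcard], by simp [hcard]⟩
    · intro w hw
      simp [hw]
    · simp [hv]

end SC

/-- For a `0`-dimensional complex `L`, the reduced cohomeology
is `ℤ` concentrated in bidegree `(0,0)`. -/
theorem HHR_zero_dimensional (L : SC) (hdim : L.dim = 0) :
    Nonempty (SC.HHR ℤ L 0 0 ≃+ ℤ) ∧
    ∀ p q : ℤ, ¬(p = 0 ∧ q = 0) → Subsingleton (SC.HHR ℤ L p q) := by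
  constructor
  · obtain ⟨v, hv⟩ := SC.exists_singleton_mem_of_dim_eq_zero hdim
    have hbot : Submodule.comap (SC.Z2R ℤ L 0 0).subtype (SC.B2R ℤ L 0 0) = ⊥ := by
      rw [SC.B2R_zero_zero_of_dim_eq_zero hdim, Submodule.comap_bot, Submodule.ker_subtype]
    exact ⟨((Submodule.quotEquivOfEqBot _ hbot).trans
      (LinearEquiv.ofBijective _ (SC.bijective_eval_Z2R_zero_zero hdim hv))).toAddEquiv⟩
  · intro p q hpq
    apply SC.subsingleton_HHR_of_le
    have hle : SC.Z2R ℤ L p q ≤ SC.NgrR ℤ L p q := inf_le_left.trans inf_le_left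
    by_cases h1 : p = -1 ∧ q = 0
    · obtain ⟨rfl, rfl⟩ := h1
      exact hle.trans (SC.NgrR_neg_one_zero_le_B2R_of_dim_eq_zero hdim)
    by_cases h2 : p = -1 ∧ q = -1
    · obtain ⟨rfl, rfl⟩ := h2
      rw [SC.Z2R_neg_one_neg_one_of_dim_eq_zero hdim]
      exact bot_le
    · rw [SC.NgrR_eq_bot_of_dim_eq_zero hdim ⟨hpq, h1, h2⟩] at hle
      exact hle.trans bot_le
end

section
/- For any finite simplicial complex K and n ≥ 1, the cohomeology group 𝓗^{n-1,n}(K) is a free abelian group. -/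
open Finset

namespace SC

theorem psgn_mul_self (v : ℕ) (s : Finset ℕ) : psgn v s * psgn v s = 1 := by
  rw [psgn, ← mul_pow]
  simp

section Graded

variable {G : Type} [AddCommGroup G] {K : SC}

theorem dvL_mem_Ngr {p q : ℤ} {c : Pr → G} (hc : c ∈ Ngr G K p (q - 1)) :
    dvL G K c ∈ Ngr G K p q := by
  intro x hx
  change dvF G K c x ≠ 0 at hx
  unfold dvF at hx
  split_ifs at hx with h
  · obtain ⟨w, hw, hne⟩ := Finset.exists_ne_zero_of_sum_ne_zero (right_ne_zero_of_smul hx)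
    split_ifs at hne with h'
    · have hs := hc _ (right_ne_zero_of_smul hne)
      have hcard := Finset.card_erase_add_one hw
      refine ⟨h.2.1, h.1, h.2.2, hs.2.2.2.1, ?_⟩
      have := hs.2.2.2.2
      simp only at this
      omega
    · exact absurd rfl hne
  · exact absurd rfl hx

theorem dhL_mem_Ngr {p q : ℤ} {c : Pr → G} (hc : c ∈ Ngr G K (p + 1) q) :
    dhL G K c ∈ Ngr G K p q := by
  intro x hx
  change dhF G K c x ≠ 0 at hx
  unfold dhF at hx
  split_ifs at hx with h
  · obtain ⟨v, hv, hne⟩ := Finset.exists_ne_zero_of_sum_ne_zero hx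
    have hs := hc _ (right_ne_zero_of_smul hne)
    have hcard := Finset.card_insert_of_notMem (Finset.mem_sdiff.mp hv).2
    refine ⟨h.2.1, h.1, h.2.2, ?_, hs.2.2.2.2⟩
    have := hs.2.2.2.1
    simp only at this
    omega
  · exact absurd rfl hx

theorem eq_of_mem_Ngr_diag {p : ℤ} {c : Pr → G} (hc : c ∈ Ngr G K p p) {x : Pr}
    (hx : c x ≠ 0) : x.1 = x.2 := by
  obtain ⟨hsub, -, -, h₁, h₂⟩ := hc x hx
  exact Finset.eq_of_subset_of_card_le hsub (by omega)

/-- On diagonal cochains the vertical differential has a single term. -/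
theorem dvL_insert {p : ℤ} {c : Pr → G} (hc : c ∈ Ngr G K p p) {s : Finset ℕ} {w : ℕ}
    (hw : w ∉ s) (hs : s ≠ ∅) (hK : insert w s ∈ K.faces) :
    dvL G K c (s, insert w s) = ((-1 : ℤ) ^ s.card) • psgn w (insert w s) • c (s, s) := by
  change dvF G K c _ = _
  rw [dvF, if_pos ⟨hK, Finset.subset_insert _ _, hs⟩]
  congr 1
  rw [Finset.sum_eq_single w]
  · simp [Finset.erase_insert hw]
  · intro b hb hbw
    split_ifs with h
    · have : c (s, (insert w s).erase b) = 0 := by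
        by_contra hne
        have heq : s = (insert w s).erase b := eq_of_mem_Ngr_diag hc hne
        have : w ∈ (insert w s).erase b := by simp [Ne.symm hbw]
        rw [← heq] at this
        exact hw this
      simp [this]
    · rfl
  · simp

theorem dhL_insert (c : Pr → G) {s : Finset ℕ} {w : ℕ}
    (hw : w ∉ s) (hs : s ≠ ∅) (hK : insert w s ∈ K.faces) :
    dhL G K c (s, insert w s) = psgn w (insert w s) • c (insert w s, insert w s) := by
  change dhF G K c _ = _
  rw [dhF, if_pos ⟨hK, Finset.subset_insert _ _, hs⟩]
  simp [Finset.insert_sdiff_cancel hw]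

theorem exists_insert_of_card {s t : Finset ℕ} (hst : s ⊆ t) (h : t.card = s.card + 1) :
    ∃ w ∉ s, insert w s = t := by
  obtain ⟨w, hw⟩ := Finset.card_eq_one.mp
    (show (t \ s).card = 1 by rw [Finset.card_sdiff_of_subset hst]; omega)
  refine ⟨w, (Finset.mem_sdiff.mp (hw ▸ Finset.mem_singleton_self w)).2, ?_⟩
  rw [Finset.insert_eq, ← hw, Finset.sdiff_union_of_subset hst]

theorem pair_eq_insert_of_card {p : ℤ} {x : Pr} (hsub : x.1 ⊆ x.2)
    (h₁ : (x.1.card : ℤ) = p + 1) (h₂ : (x.2.card : ℤ) = p + 1 + 1) :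
    ∃ w ∉ x.1, x = (x.1, insert w x.1) := by
  obtain ⟨w, hw, h⟩ := exists_insert_of_card hsub (by omega)
  exact ⟨w, hw, Prod.ext rfl h.symm⟩

end Graded

/-- Vertical cocycles on the diagonal are stable under entrywise maps fixing zero. -/
theorem comp_mem_ker_dvL {K : SC} {p : ℤ} {c : Pr → ℤ}
    (hc : c ∈ Ngr ℤ K p p ⊓ LinearMap.ker (dvL ℤ K)) {f : ℤ → ℤ} (hf : f 0 = 0) :
    (fun x => f (c x)) ∈ Ngr ℤ K p p ⊓ LinearMap.ker (dvL ℤ K) := by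
  have hmem : (fun x => f (c x)) ∈ Ngr ℤ K p p := fun x hx =>
    hc.1 x fun h => hx (by simp [h, hf])
  refine ⟨hmem, ?_⟩
  refine LinearMap.mem_ker.mpr ?_
  funext x
  by_contra hx
  obtain ⟨hsub, hK, hs, h₁, h₂⟩ :=
    dvL_mem_Ngr (q := p + 1) (by simpa using hmem) x hx
  obtain ⟨w, hw, hxw⟩ := pair_eq_insert_of_card hsub h₁ h₂
  have hK' : insert w x.1 ∈ K.faces := by rw [hxw] at hK; exact hK
  have h0 : dvL ℤ K c (x.1, insert w x.1) = 0 := by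
    rw [LinearMap.mem_ker.mp hc.2]; rfl
  rw [dvL_insert hc.1 hw hs hK'] at h0
  have hc0 : c (x.1, x.1) = 0 := by simpa [psgn] using h0
  rw [hxw, dvL_insert hmem hw hs hK'] at hx
  simp [hc0, hf] at hx

/-- The `E₂`-coboundaries in bidegree `(p, p + 1)` form a saturated submodule. -/
theorem mem_B2_of_smul_mem {K : SC} {p k : ℤ} (hk : k ≠ 0) {c : Pr → ℤ}
    (hc : c ∈ Ngr ℤ K p (p + 1)) (h : k • c ∈ B2 ℤ K p (p + 1)) :
    c ∈ B2 ℤ K p (p + 1) := by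
  obtain ⟨_, ⟨a, ha, rfl⟩, _, ⟨b, hb, rfl⟩, hab⟩ :=
    (Submodule.mem_sup.mp h.1 : ∃ y ∈ _, ∃ z ∈ _, y + z = k • c)
  have ha₀ : a ∈ Ngr ℤ K p p := by simpa using ha
  -- Entrywise floor division by `k` sends primitives of `k • c` to primitives of `c`.
  let a' : Pr → ℤ := fun x => (-1) ^ x.1.card * ((-1) ^ x.1.card * a x / k)
  let b' : Pr → ℤ := fun x => -(-b x / k)
  have ha' : a' ∈ Ngr ℤ K p p := fun x hx => ha₀ x fun h0 => hx (by simp [a', h0])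
  have hb' : b' ∈ Ngr ℤ K (p + 1) (p + 1) ⊓ LinearMap.ker (dvL ℤ K) :=
    comp_mem_ker_dvL (f := fun z => -(-z / k)) hb (by simp)
  have ha'' : a' ∈ Ngr ℤ K p (p + 1 - 1) := by simpa using ha'
  have hsum : dvL ℤ K a' + dhL ℤ K b' ∈ Ngr ℤ K p (p + 1) :=
    add_mem (dvL_mem_Ngr ha'') (dhL_mem_Ngr hb'.1)
  refine ⟨Submodule.mem_sup.mpr ⟨_, ⟨a', ha'', rfl⟩, _, ⟨b', hb', rfl⟩, ?_⟩, hc⟩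
  rw [← sub_eq_zero]
  funext x
  by_contra hx
  obtain ⟨hsub, hK, hs, h₁, h₂⟩ := sub_mem hsum hc x hx
  apply hx
  obtain ⟨w, hw, hxw⟩ := pair_eq_insert_of_card hsub h₁ h₂
  have hK' : insert w x.1 ∈ K.faces := by rw [hxw] at hK; exact hK
  have key := congrFun hab (x.1, insert w x.1)
  rw [hxw]
  simp only [Pi.add_apply, Pi.sub_apply, Pi.smul_apply, Pi.zero_apply, smul_eq_mul,
    dvL_insert ha₀ hw hs hK', dvL_insert ha' hw hs hK', dhL_insert _ hw hs hK'] at key ⊢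
  have hε := psgn_mul_self w (insert w x.1)
  have hm : ((-1 : ℤ) ^ x.1.card) * (-1) ^ x.1.card = 1 := by rw [← mul_pow]; simp
  simp only [a', b']
  generalize psgn w (insert w x.1) = ε at *
  generalize ((-1 : ℤ) ^ x.1.card) = m at *
  generalize a (x.1, x.1) = A at *
  generalize b (insert w x.1, insert w x.1) = B at *
  generalize c (x.1, insert w x.1) = C at *
  have hdiv : m * A / k = -B / k + ε * C := by
    rw [← Int.add_mul_ediv_right _ _ hk]
    congr 1
    linear_combination ε * key - (m * A + B) * hε
  rw [hdiv]
  linear_combination ε * (-B / k + ε * C) * hm + C * hε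

theorem finite_of_le_Ngr {K : SC} {p q : ℤ} {M : Submodule ℤ (Pr → ℤ)} (hM : M ≤ Ngr ℤ K p q) :
    Module.Finite ℤ M := by
  let r : (Pr → ℤ) →ₗ[ℤ] ((K.faces ×ˢ K.faces : Finset Pr) → ℤ) :=
    LinearMap.funLeft ℤ ℤ Subtype.val
  refine Module.Finite.of_injective (r.comp M.subtype) ?_
  rw [← LinearMap.ker_eq_bot, LinearMap.ker_eq_bot']
  intro c hc
  ext x
  by_contra hx
  obtain ⟨hsub, hK, -⟩ := hM c.2 x hx
  exact hx (congrFun hc ⟨x, Finset.mem_product.mpr ⟨K.down_closed hK hsub, hK⟩⟩)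

end SC

/-- `𝓗^{n-1,n}(K)` is a free abelian group for `n ≥ 1`. -/
theorem HH_n_sub_one_n_free (K : SC) (n : ℤ) (hn : 1 ≤ n) :
    Module.Free ℤ (SC.HH ℤ K (n - 1) n) := by
  obtain ⟨p, rfl⟩ : ∃ p, n = p + 1 := ⟨n - 1, by ring⟩
  rw [add_sub_cancel_right]
  have hZ : SC.Z2 ℤ K p (p + 1) ≤ SC.Ngr ℤ K p (p + 1) := inf_le_left.trans inf_le_left
  have : Module.Finite ℤ (SC.Z2 ℤ K p (p + 1)) := SC.finite_of_le_Ngr hZ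
  have : Module.IsTorsionFree ℤ (SC.HH ℤ K p (p + 1)) := by
    rw [Module.isTorsionFree_iff_smul_eq_zero]
    intro k m hkm
    obtain ⟨c, rfl⟩ := Submodule.Quotient.mk_surjective _ m
    refine or_iff_not_imp_left.mpr fun hk => ?_
    rw [← Submodule.Quotient.mk_smul, Submodule.Quotient.mk_eq_zero] at hkm
    rw [Submodule.Quotient.mk_eq_zero]
    exact SC.mem_B2_of_smul_mem hk (hZ c.2) hkm
  exact Module.free_of_finite_type_torsion_free'
end

section
/- For a finite simplicial complex K with vertex set S, the element λ = Σ_{σ ∈ K, σ ≠ ∅} (−1)^{⌊(|σ|−1)/2⌋} σ⊗σ in N^{*,*}(K) satisfies Δ(λ) = 0, where Δ(σ⊗τ) = dσ⊗τ + (−1)^{|σ|} σ⊗δτ. -/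
open Finset

/-- The coefficient of `λ` at a simplex with `n + 1` vertices cancels the signed one at its facets. -/
theorem neg_one_pow_half_add {n : ℕ} (hn : 0 < n) :
    (-1 : ℤ) ^ (n / 2) + (-1) ^ n * (-1) ^ ((n - 1) / 2) = 0 := by
  rw [← pow_add]
  rcases Nat.even_or_odd' n with ⟨k, rfl | rfl⟩
  · obtain ⟨j, rfl⟩ : ∃ j, k = j + 1 := ⟨k - 1, by omega⟩
    rw [show 2 * (j + 1) / 2 = j + 1 by omega,
      show 2 * (j + 1) + (2 * (j + 1) - 1) / 2 = 2 * (j + 1) + j by omega]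
    simp [pow_add, pow_mul]
  · rw [show (2 * k + 1) / 2 = k by omega,
      show 2 * k + 1 + (2 * k + 1 - 1) / 2 = 2 * k + 1 + k by omega]
    simp [pow_add, pow_mul]

/-- On pairs `σ ⊆ τ`, the vertical differential is a sum over the vertices of `τ` outside `σ`. -/
theorem sum_ite_subset_erase {M : Type*} [AddCommMonoid M] {σ τ : Finset ℕ} (hστ : σ ⊆ τ)
    (f : ℕ → M) :
    ∑ w ∈ τ, (if σ ⊆ τ.erase w then f w else 0) = ∑ w ∈ τ \ σ, f w := by
  rw [← Finset.sum_filter]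
  refine Finset.sum_congr ?_ fun _ _ => rfl
  ext w
  simp [Finset.subset_erase, hστ]

/-- The element `λ = Σ_σ (−1)^{⌊(|σ|−1)/2⌋} σ⊗σ` of
`N^{*,*}(K)` is a `Δ`-cocycle. -/
theorem lambda_cocycle (K : SC) (lam : SC.Pr → ℤ)
    (hlam : lam = fun x => if x.1 = x.2 ∧ x.1 ∈ K.faces ∧ x.1 ≠ ∅ then
      (-1 : ℤ) ^ ((x.1.card - 1) / 2) else 0) :
    SC.dL ℤ K lam = 0 := by
  funext ⟨σ, τ⟩
  change SC.dhF ℤ K lam (σ, τ) + SC.dvF ℤ K lam (σ, τ) = 0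
  simp only [SC.dhF, SC.dvF]
  split_ifs with h
  · obtain ⟨hτ, hστ, hσ⟩ := h
    rw [sum_ite_subset_erase hστ, Finset.smul_sum, ← Finset.sum_add_distrib]
    refine Finset.sum_eq_zero fun v hv => ?_
    obtain ⟨hvτ, hvσ⟩ := Finset.mem_sdiff.mp hv
    subst hlam
    by_cases heq : insert v σ = τ
    · subst heq
      have hσK : σ ∈ K.faces := K.down_closed hτ hστ
      have hsign := neg_one_pow_half_add (Finset.card_pos.mpr (Finset.nonempty_iff_ne_empty.mpr hσ))
      simp only [Finset.erase_insert hvσ, hτ, hσK, hσ, Finset.insert_ne_empty, ne_eq,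
        not_false_eq_true, and_self, if_true, Finset.card_insert_of_notMem hvσ,
        Nat.add_sub_cancel, smul_eq_mul]
      linear_combination SC.psgn v (insert v σ) * hsign
    · have herase : σ ≠ τ.erase v := by
        rintro rfl
        exact heq (Finset.insert_erase hvτ)
      simp [heq, herase]
  · simp
end
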